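/- Assume (H1), (H2), (H3), (H_fitz), suppose limsup_{t→∞} λ(t)β(t) < 2μ, let x be a strong global solution of the dynamical system, and assume in addition that A is γ-strongly monotone for some γ > 0. Let z be the unique element of zer(A + D + N_C). Then ∫₀^∞ λ(t) ‖x(t) − z‖² dt < ∞. -/

import Mathlib

open scoped RealInnerProductSpace Pointwise
open MeasureTheory Filter

variable {H : Type*} [NormedAddCommGroup H] [InnerProductSpace ℝ H]

/-- A set-valued operator `A : H ⇒ H` (given by its value map) is monotone. -/
def MonotoneOperator (A : H → Set H) : Prop :=
  ∀ ⦃x u y v : H⦄, u ∈ A x → v ∈ A y → (0:ℝ) ≤ ⟪x - y, u - v⟫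

/-- `A` is maximally monotone: monotone and without proper monotone extension. -/
def MaximallyMonotone (A : H → Set H) : Prop :=
  MonotoneOperator A ∧ ∀ A' : H → Set H, MonotoneOperator A' → (∀ x, A x ⊆ A' x) → A' = A

/-- `A` is `γ`-strongly monotone. -/
def StronglyMonotoneOperator (γ : ℝ) (A : H → Set H) : Prop :=
  ∀ ⦃x u y v : H⦄, u ∈ A x → v ∈ A y → γ * ‖x - y‖ ^ 2 ≤ ⟪x - y, u - v⟫

/-- A single-valued operator `T` is `γ`-cocoercive. -/
def Cocoercive (γ : ℝ) (T : H → H) : Prop :=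
  ∀ x y : H, γ * ‖T x - T y‖ ^ 2 ≤ ⟪x - y, T x - T y⟫

/-- The normal cone of a set `C` at `z` (empty when `z ∉ C`). -/
def normalCone (C : Set H) (z : H) : Set H :=
  {u | z ∈ C ∧ ∀ y ∈ C, ⟪y - z, u⟫ ≤ (0:ℝ)}

/-- The support function `σ_C`, with values in `ℝ ∪ {±∞}`. -/
noncomputable def supportFn (C : Set H) (u : H) : EReal :=
  ⨆ y ∈ C, ((⟪y, u⟫ : ℝ) : EReal)

/-- The Fitzpatrick function of a single-valued operator `B`. -/
noncomputable def fitzpatrick (B : H → H) (x u : H) : EReal :=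
  ⨆ y : H, ((⟪x, B y⟫ + ⟪y, u⟫ - ⟪y, B y⟫ : ℝ) : EReal)

/-- Conversion of an extended real into `[0,∞]` (negative values go to `0`). -/
noncomputable def erealToENNReal (x : EReal) : ENNReal :=
  if x = ⊤ then ⊤ else ENNReal.ofReal x.toReal

/-- Absolute continuity of `f` on `[0,b]`, via the `ε`-`η` definition. -/
def AbsolutelyContinuousOnIcc (f : ℝ → H) (b : ℝ) : Prop :=
  ∀ ε > (0:ℝ), ∃ η > (0:ℝ), ∀ (n : ℕ) (a c : Fin n → ℝ),
    (∀ k, 0 ≤ a k ∧ a k ≤ c k ∧ c k ≤ b) →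
    (Pairwise fun i j => Disjoint (Set.Ioo (a i) (c i)) (Set.Ioo (a j) (c j))) →
    ∑ k, (c k - a k) < η → ∑ k, ‖f (c k) - f (a k)‖ < ε

/-- A strong global solution `x`, with derivative function `xd`, of the dynamical system
`ẋ(t) + x(t) = J_{λ(t)A}(x(t) − λ(t)Dx(t) − λ(t)β(t)Bx(t))`, `x(0) = x₀`, where the
resolvent equation is expressed as the differential inclusion
`x(t) − λ(t)Dx(t) − λ(t)β(t)Bx(t) − (ẋ(t)+x(t)) ∈ λ(t) A(ẋ(t)+x(t))`. -/
def IsStrongGlobalSolution (A : H → Set H) (D B : H → H) (lam beta : ℝ → ℝ)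
    (x₀ : H) (x xd : ℝ → H) : Prop :=
  (∀ b > (0:ℝ), AbsolutelyContinuousOnIcc x b) ∧ x 0 = x₀ ∧
  ∀ᵐ t ∂(volume.restrict (Set.Ici (0:ℝ))),
    HasDerivAt x (xd t) t ∧
    x t - lam t • D (x t) - (lam t * beta t) • B (x t) - (xd t + x t)
      ∈ lam t • A (xd t + x t)

/-- The solution set `zer(A + D + N_C)`. -/
def zerSum (A : H → Set H) (D : H → H) (C : Set H) : Set H :=
  {z | ∃ v ∈ A z, ∃ p ∈ normalCone C z, v + D z + p = 0}

lemma aux_pointwise (l be γ η μ : ℝ) (hl : 0 < l) (hbe : 0 < be) (hγ : 0 < γ) (hη : 0 < η)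
    (hμ : 0 < μ) (hlb : l * be ≤ 2 * μ) (X e d bb p w : H)
    (hw : l • w = -e - l • d - (l * be) • bb + l • p)
    (h1 : γ * ‖X + e‖ ^ 2 ≤ ⟪X + e, w⟫)
    (hd : η * ‖d‖ ^ 2 ≤ ⟪X, d⟫) (hb : μ * ‖bb‖ ^ 2 ≤ ⟪X, bb⟫) :
    2 * ⟪X, e⟫ + (2 * γ) * (l * ‖X‖ ^ 2) ≤ (6 / η ^ 2 + 24 * γ ^ 2) * (l ^ 2 * ‖X‖ ^ 2)
      + (6 * ‖p‖ ^ 2 * l ^ 2 + 2 / 3 * max (l * ⟪X, (3:ℝ) • p⟫ - l * be * ⟪X, bb⟫) 0) := by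
  have h2 : l * (γ * ‖X + e‖ ^ 2) ≤ ⟪X + e, l • w⟫ := by
    rw [real_inner_smul_right]; exact mul_le_mul_of_nonneg_left h1 hl.le
  rw [hw] at h2
  simp only [inner_add_left, inner_add_right, inner_sub_right, inner_neg_right,
    real_inner_smul_right, norm_add_sq_real, real_inner_self_eq_norm_sq] at h2
  rw [real_inner_smul_right]
  have hm := le_max_left (l * (3 * ⟪X, p⟫) - l * be * ⟪X, bb⟫) 0
  have i1 : |⟪X, e⟫| ≤ ‖X‖ * ‖e‖ := abs_real_inner_le_norm X e
  have i2 : |⟪e, d⟫| ≤ ‖e‖ * ‖d‖ := abs_real_inner_le_norm e d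
  have i3 : |⟪e, bb⟫| ≤ ‖e‖ * ‖bb‖ := abs_real_inner_le_norm e bb
  have i4 : |⟪e, p⟫| ≤ ‖e‖ * ‖p‖ := abs_real_inner_le_norm e p
  have i5 : ⟪X, d⟫ ≤ ‖X‖ * ‖d‖ := real_inner_le_norm X d
  have hdX : η * ‖d‖ ≤ ‖X‖ := by
    by_cases h0 : ‖d‖ = 0
    · rw [h0]; simp
    · have : 0 < ‖d‖ := lt_of_le_of_ne (norm_nonneg _) (Ne.symm h0)
      have h3 : (η * ‖d‖) * ‖d‖ ≤ ‖X‖ * ‖d‖ := by nlinarith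
      exact le_of_mul_le_mul_right h3 this
  have hdX2 : ‖d‖ ^ 2 ≤ ‖X‖ ^ 2 / η ^ 2 := by
    rw [le_div_iff₀ (by positivity)]
    have := pow_le_pow_left₀ (by positivity) hdX 2
    nlinarith
  -- Young inequalities
  have y1 : -(2 * γ * l * ⟪X, e⟫) ≤ ‖e‖ ^ 2 / 12 + 12 * γ ^ 2 * (l ^ 2 * ‖X‖ ^ 2) := by
    have a1 : -⟪X, e⟫ ≤ ‖X‖ * ‖e‖ := (neg_le_abs _).trans i1
    have a2 := mul_le_mul_of_nonneg_left a1 (show 0 ≤ 2 * γ * l by positivity)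
    linarith [sq_nonneg (‖e‖ - 12 * γ * l * ‖X‖)]
  have y2 : -(l * ⟪e, d⟫) ≤ ‖e‖ ^ 2 / 12 + 3 / η ^ 2 * (l ^ 2 * ‖X‖ ^ 2) := by
    have a1 : -⟪e, d⟫ ≤ ‖e‖ * ‖d‖ := (neg_le_abs _).trans i2
    have a2 := mul_le_mul_of_nonneg_left a1 hl.le
    have a3 := mul_le_mul_of_nonneg_left hdX2 (show 0 ≤ 3 * l ^ 2 by positivity)
    have a4 : 3 * l ^ 2 * (‖X‖ ^ 2 / η ^ 2) = 3 / η ^ 2 * (l ^ 2 * ‖X‖ ^ 2) := by ring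
    rw [← a4]
    linarith [sq_nonneg (‖e‖ - 6 * l * ‖d‖)]
  have y3 : -(l * be * ⟪e, bb⟫) ≤ 3 / 4 * ‖e‖ ^ 2 + 2 / 3 * (l * be * ⟪X, bb⟫) := by
    have hlb0 : 0 < l * be := by positivity
    have a1 : -⟪e, bb⟫ ≤ ‖e‖ * ‖bb‖ := (neg_le_abs _).trans i3
    have a2 := mul_le_mul_of_nonneg_left a1 hlb0.le
    have a3 := mul_le_mul_of_nonneg_left hb hlb0.le
    have a4 : (l * be) * (l * be * ‖bb‖ ^ 2) ≤ (2 * μ) * (l * be * ‖bb‖ ^ 2) :=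
      mul_le_mul_of_nonneg_right hlb (by positivity)
    linarith [sq_nonneg (3 * ‖e‖ - 2 * (l * be) * ‖bb‖)]
  have y4 : l * ⟪e, p⟫ ≤ ‖e‖ ^ 2 / 12 + 3 * ‖p‖ ^ 2 * l ^ 2 := by
    have a1 : ⟪e, p⟫ ≤ ‖e‖ * ‖p‖ := (le_abs_self _).trans i4
    have a2 := mul_le_mul_of_nonneg_left a1 hl.le
    linarith [sq_nonneg (‖e‖ - 6 * l * ‖p‖)]
  have y5 : 0 ≤ l * ⟪X, d⟫ := mul_nonneg hl.le (le_trans (by positivity) hd)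
  have y6 : 0 ≤ l * γ * ‖e‖ ^ 2 := by positivity
  have e1 : ⟪e, X⟫ = ⟪X, e⟫ := real_inner_comm _ _
  have e2 : 6 / η ^ 2 = 2 * (3 / η ^ 2) := by ring
  rw [e2]
  generalize 3 / η ^ 2 = k at *
  linarith

lemma aux_ac0 {Y : Type*} [NormedAddCommGroup Y] (x : ℝ → H) (f : ℝ → Y) (b : ℝ) (hb : 0 < b)
    (hf : ∀ s t, ‖f s - f t‖ ≤ ‖x s - x t‖) (h : AbsolutelyContinuousOnIcc x b) :
    AbsolutelyContinuousOnInterval f 0 b := by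
    rw [absolutelyContinuousOnInterval_iff]
    intro ε hε
    obtain ⟨δ, hδ, hh⟩ := h ε hε
    refine ⟨δ, hδ, ?_⟩
    rintro ⟨n, I⟩ ⟨hI1, hI2⟩ hs
    simp only [Finset.mem_range, Set.uIcc_of_le hb.le] at hI1 hI2 hs ⊢
    have key := hh n (fun k => min (I k).1 (I k).2) (fun k => max (I k).1 (I k).2) ?_ ?_ ?_
    · refine lt_of_le_of_lt ?_ key
      rw [Finset.sum_range]
      refine Finset.sum_le_sum fun k _ => ?_
      rw [dist_eq_norm]
      have h3 := hf (I k).1 (I k).2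
      rcases le_total (I k).1 (I k).2 with h4 | h4
      · simp only [min_eq_left h4, max_eq_right h4]; rw [norm_sub_rev (x _)]; exact h3
      · simp only [min_eq_right h4, max_eq_left h4]; exact h3
    · intro k
      have := hI1 k k.2
      exact ⟨le_min this.1.1 this.2.1, min_le_max, max_le this.1.2 this.2.2⟩
    · intro i j hij
      have := hI2 (by simp : (i:ℕ) ∈ ((Finset.range n : Finset ℕ) : Set ℕ))
        (by simp : (j:ℕ) ∈ ((Finset.range n : Finset ℕ) : Set ℕ)) (by simpa [Fin.val_inj] using hij)
      exact Disjoint.mono Set.Ioo_subset_Ioc_self Set.Ioo_subset_Ioc_self this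
    · rw [Finset.sum_range] at hs
      refine lt_of_le_of_lt (le_of_eq (Finset.sum_congr rfl fun k _ => ?_)) hs
      rw [Real.dist_eq, abs_sub_comm, max_sub_min_eq_abs]

lemma aux_ac (x : ℝ → H) (b : ℝ) (hb : 0 < b) (z : H) (h : AbsolutelyContinuousOnIcc x b) :
    AbsolutelyContinuousOnInterval (fun t => ‖x t - z‖ ^ 2) 0 b := by
  have h1 : AbsolutelyContinuousOnInterval (fun t => ‖x t - z‖) 0 b :=
    aux_ac0 x _ b hb (fun s t => by
      have := abs_norm_sub_norm_le (x s - z) (x t - z)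
      rw [sub_sub_sub_cancel_right] at this
      exact this) h
  have h2 := h1.mul h1
  convert h2 using 1
  ext t; simp [sq]

lemma aux_gronwall (T c K : ℝ) (hc : 0 < c) (hK : 0 ≤ K) (N l R : ℝ → ℝ) (hl : Continuous l)
    (hl0 : ∀ t, 0 ≤ l t) (hN0 : ∀ t, 0 ≤ N t) (hR0 : ∀ t, 0 ≤ R t)
    (hR : IntegrableOn R (Set.Ioi T)) (hl2 : IntegrableOn (fun t => l t ^ 2) (Set.Ioi T))
    (hN : ∀ b > T, AbsolutelyContinuousOnInterval N T b)
    (hd : ∀ᵐ t ∂(volume.restrict (Set.Ioi T)), ∃ d, HasDerivAt N d t ∧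
      d + c * (l t * N t) ≤ K * (l t ^ 2 * N t) + R t) :
    IntegrableOn (fun t => l t * N t) (Set.Ioi T) := by
  set G : ℝ → ℝ := fun t => ∫ s in T..t, l s ^ 2 with hG
  have hGd : ∀ t, HasDerivAt G (l t ^ 2) t := fun t =>
    (hl.pow 2).integral_hasStrictDerivAt T t |>.hasDerivAt
  set E : ℝ → ℝ := fun t => Real.exp (-(K * G t)) with hE
  have hEd : ∀ t, HasDerivAt E (E t * -(K * l t ^ 2)) t := fun t =>
    (((hGd t).const_mul K).neg).exp
  have hEc : ContDiff ℝ 1 E := by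
    rw [contDiff_one_iff_deriv]
    refine ⟨fun t => (hEd t).differentiableAt, ?_⟩
    have : deriv E = fun t => E t * -(K * l t ^ 2) := funext fun t => (hEd t).deriv
    rw [this]
    have hEcont : Continuous E := continuous_iff_continuousAt.2 fun t => (hEd t).continuousAt
    fun_prop
  set I2 := ∫ t in Set.Ioi T, l t ^ 2
  have hGle : ∀ t, T ≤ t → G t ≤ I2 := by
    intro t ht
    simp only [hG, intervalIntegral.integral_of_le ht]
    exact setIntegral_mono_set hl2 (ae_of_all _ fun s => sq_nonneg _)
      (Set.Ioc_subset_Ioi_self.eventuallyLE)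
  have hG0 : ∀ t, T ≤ t → 0 ≤ G t := fun t ht =>
    intervalIntegral.integral_nonneg ht fun s _ => sq_nonneg _
  set e0 := Real.exp (-(K * I2))
  have he0 : 0 < e0 := Real.exp_pos _
  have hEe0 : ∀ t, T ≤ t → e0 ≤ E t := fun t ht => by
    apply Real.exp_le_exp.2
    have := mul_le_mul_of_nonneg_left (hGle t ht) hK
    linarith
  have hE1 : ∀ t, T ≤ t → E t ≤ 1 := fun t ht => by
    apply Real.exp_le_one_iff.2
    have := mul_nonneg hK (hG0 t ht)
    linarith
  have hET : E T = 1 := by simp [hE, hG]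
  have hNc : ∀ b > T, ContinuousOn (fun t => l t * N t) (Set.uIcc T b) := fun b hb =>
    hl.continuousOn.mul (hN b hb).continuousOn
  refine integrableOn_Ioi_of_intervalIntegral_norm_bounded
    ((N T + ∫ t in Set.Ioi T, R t) / (c * e0)) T (b := fun n : ℕ => T + 1 + n) (l := atTop) ?_ ?_ ?_
  · intro n
    have hb : T < T + 1 + n := by have := Nat.cast_nonneg (α := ℝ) n; linarith
    have := (hNc _ hb).intervalIntegrable (μ := volume)
    rwa [intervalIntegrable_iff_integrableOn_Ioc_of_le hb.le] at this
  · exact tendsto_atTop_add_const_left _ _ tendsto_natCast_atTop_atTop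
  · refine Eventually.of_forall fun n => ?_
    set b : ℝ := T + 1 + n
    have hb : T < b := by have := Nat.cast_nonneg (α := ℝ) n; linarith
    have hac : AbsolutelyContinuousOnInterval (E * N) T b :=
      (hEc.contDiffOn.absolutelyContinuousOnInterval).mul (hN b hb)
    have hint := hac.integral_deriv_eq_sub
    have hdi := hac.intervalIntegrable_deriv
    have hRi : IntervalIntegrable R volume T b := by
      rw [intervalIntegrable_iff_integrableOn_Ioc_of_le hb.le]
      exact hR.mono_set Set.Ioc_subset_Ioi_self
    have hLi : IntervalIntegrable (fun t => c * e0 * (l t * N t)) volume T b :=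
      ((hNc b hb).intervalIntegrable).const_mul _
    have hle : ∫ t in T..b, deriv (E * N) t ≤ ∫ t in T..b, (R t - c * e0 * (l t * N t)) := by
      apply intervalIntegral.integral_mono_ae_restrict hb.le hdi (hRi.sub hLi)
      have hd' : ∀ᵐ t ∂(volume.restrict (Set.Icc T b)), ∃ d, HasDerivAt N d t ∧
          d + c * (l t * N t) ≤ K * (l t ^ 2 * N t) + R t := by
        rw [← restrict_Ioc_eq_restrict_Icc]
        exact ae_restrict_of_ae_restrict_of_subset Set.Ioc_subset_Ioi_self hd
      filter_upwards [hd', ae_restrict_mem measurableSet_Icc] with t ht htm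
      obtain ⟨d, hd1, hd2⟩ := ht
      rw [((hEd t).mul hd1).deriv]
      have a1 := hEe0 t htm.1
      have a2 := hE1 t htm.1
      have a3 := mul_le_mul_of_nonneg_left hd2 (he0.le.trans a1)
      have a4 := mul_le_mul_of_nonneg_right a2 (hR0 t)
      have a5 : 0 ≤ c * (l t * N t) := mul_nonneg hc.le (mul_nonneg (hl0 t) (hN0 t))
      have a6 := mul_le_mul_of_nonneg_right a1 a5
      linarith
    rw [hint, intervalIntegral.integral_sub hRi hLi, intervalIntegral.integral_const_mul] at hle
    have hRle : ∫ t in T..b, R t ≤ ∫ t in Set.Ioi T, R t := by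
      rw [intervalIntegral.integral_of_le hb.le]
      exact setIntegral_mono_set hR (ae_of_all _ hR0) (Set.Ioc_subset_Ioi_self.eventuallyLE)
    have hEN : 0 ≤ E b * N b := mul_nonneg (Real.exp_pos _).le (hN0 b)
    simp only [Pi.mul_apply, hET, one_mul] at hle
    have hnn : ∫ t in T..b, ‖l t * N t‖ = ∫ t in T..b, l t * N t := by
      congr 1; ext t; exact Real.norm_of_nonneg (mul_nonneg (hl0 t) (hN0 t))
    rw [hnn, le_div_iff₀ (by positivity)]
    linarith

lemma aux_fitz (B : H → H) (z p X : H) (l be : ℝ) (hl : 0 < l) (hbe : 0 < be)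
    (hp : p ∈ normalCone {q : H | B q = 0} z) :
    ENNReal.ofReal (l * ⟪X - z, p⟫ - l * be * ⟪X - z, B X⟫) ≤
      ENNReal.ofReal (l * be) *
        erealToENNReal ((⨆ u ∈ {q : H | B q = 0}, fitzpatrick B u (be⁻¹ • p)) -
          supportFn {q : H | B q = 0} (be⁻¹ • p)) := by
  have hσ : supportFn {q : H | B q = 0} (be⁻¹ • p) = ((⟪z, be⁻¹ • p⟫ : ℝ) : EReal) := by
    apply le_antisymm
    · refine iSup₂_le fun y hy => ?_
      have := hp.2 y hy
      rw [inner_sub_left] at this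
      rw [EReal.coe_le_coe_iff, real_inner_smul_right, real_inner_smul_right]
      exact mul_le_mul_of_nonneg_left (by linarith) (by positivity)
    · exact le_iSup₂ (f := fun y (_ : y ∈ {q : H | B q = 0}) => ((⟪y, be⁻¹ • p⟫ : ℝ) : EReal)) z hp.1
  have hS : ((⟪z, B X⟫ + ⟪X, be⁻¹ • p⟫ - ⟪X, B X⟫ : ℝ) : EReal) ≤
      ⨆ u ∈ {q : H | B q = 0}, fitzpatrick B u (be⁻¹ • p) :=
    le_trans (le_iSup (fun y : H => ((⟪z, B y⟫ + ⟪y, be⁻¹ • p⟫ - ⟪y, B y⟫ : ℝ) : EReal)) X)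
      (le_iSup₂ (f := fun u (_ : u ∈ {q : H | B q = 0}) => fitzpatrick B u (be⁻¹ • p)) z hp.1)
  rw [hσ]
  generalize (⨆ u ∈ {q : H | B q = 0}, fitzpatrick B u (be⁻¹ • p)) = S at *
  have hlb : 0 < l * be := by positivity
  induction S with
  | bot => exact absurd (le_bot_iff.1 hS) (EReal.coe_ne_bot _)
  | top =>
    rw [EReal.top_sub_coe]
    simp [erealToENNReal, ENNReal.mul_top, hlb]
  | coe s =>
    rw [EReal.coe_le_coe_iff] at hS
    rw [← EReal.coe_sub]
    simp only [erealToENNReal, EReal.coe_ne_top, if_false, EReal.toReal_coe]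
    rw [← ENNReal.ofReal_mul hlb.le]
    apply ENNReal.ofReal_le_ofReal
    have := mul_le_mul_of_nonneg_left hS hlb.le
    rw [real_inner_smul_right] at this ⊢
    rw [inner_sub_left, inner_sub_left]
    have e1 : l * be * (be⁻¹ * ⟪X, p⟫) = l * ⟪X, p⟫ := by field_simp
    have e2 : l * be * (be⁻¹ * ⟪z, p⟫) = l * ⟪z, p⟫ := by field_simp
    linarith

lemma aux_cont_Ici {Y : Type*} [TopologicalSpace Y] (f : ℝ → Y)
    (h : ∀ b > (0:ℝ), ContinuousOn f (Set.Icc 0 b)) : ContinuousOn f (Set.Ici 0) := by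
  intro t ht
  have ht0 : (0:ℝ) ≤ t := ht
  refine ((h (t + 1) (by linarith)) t ⟨ht0, by linarith⟩).mono_of_mem_nhdsWithin ?_
  have : Set.Icc 0 (t + 1) = Set.Ici 0 ∩ Set.Iic (t + 1) := by ext; simp
  rw [this]
  exact inter_mem self_mem_nhdsWithin (mem_nhdsWithin_of_mem_nhds (Iic_mem_nhds (by linarith)))

lemma aux_coco_cont (μ : ℝ) (hμ : 0 < μ) (B : H → H) (hB : Cocoercive μ B) : Continuous B := by
  have : LipschitzWith (Real.toNNReal μ⁻¹) B := by
    refine LipschitzWith.of_dist_le_mul fun x y => ?_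
    rw [Real.coe_toNNReal _ (by positivity), dist_eq_norm, dist_eq_norm]
    have h1 := hB x y
    have h2 := real_inner_le_norm (x - y) (B x - B y)
    rw [inv_mul_eq_div, le_div_iff₀ hμ]
    by_cases h0 : ‖B x - B y‖ = 0
    · rw [h0]; simp
    · have : 0 < ‖B x - B y‖ := lt_of_le_of_ne (norm_nonneg _) (Ne.symm h0)
      refine le_of_mul_le_mul_right ?_ this
      nlinarith
  exact this.continuous

/-- under strong monotonicity of `A`, for the unique `z ∈ zer(A + D + N_C)`
one has `∫₀^∞ λ(t)‖x(t) − z‖² dt < ∞`. -/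
theorem strongly_monotone_integral_estimate [CompleteSpace H]
    (A : H → Set H) (hA : MaximallyMonotone A)
    (η μ : ℝ) (hη : 0 < η) (hμ : 0 < μ)
    (D B : H → H) (hD : Cocoercive η D) (hB : Cocoercive μ B)
    (hC : {q : H | B q = 0}.Nonempty)
    (lam beta : ℝ → ℝ)
    (hlam_pos : ∀ t : ℝ, 0 ≤ t → 0 < lam t) (hbeta_pos : ∀ t : ℝ, 0 ≤ t → 0 < beta t)
    (hH1 : ∀ b > (0:ℝ), ContinuousOn lam (Set.Icc 0 b) ∧ ContinuousOn beta (Set.Icc 0 b))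
    (hH2 : MaximallyMonotone (fun q => A q + normalCone {q' : H | B q' = 0} q) ∧
      (zerSum A D {q : H | B q = 0}).Nonempty)
    (hH3 : IntegrableOn (fun t => lam t ^ 2) (Set.Ici (0:ℝ)) volume ∧
      ∫⁻ t in Set.Ici (0:ℝ), ENNReal.ofReal (lam t) = ⊤)
    (hfitz : ∀ p z : H, p ∈ normalCone {q : H | B q = 0} z →
      ∫⁻ t in Set.Ici (0:ℝ), ENNReal.ofReal (lam t * beta t) *
        erealToENNReal ((⨆ u ∈ {q : H | B q = 0}, fitzpatrick B u ((beta t)⁻¹ • p)) -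
          supportFn {q : H | B q = 0} ((beta t)⁻¹ • p)) < ⊤)
    (hls : limsup (fun t => ((lam t * beta t : ℝ) : EReal)) atTop < ((2 * μ : ℝ) : EReal))
    (x₀ : H) (x xd : ℝ → H)
    (hsol : IsStrongGlobalSolution A D B lam beta x₀ x xd)
    (γ : ℝ) (hγ : 0 < γ) (hsm : StronglyMonotoneOperator γ A)
    (z : H) (hz : zerSum A D {q : H | B q = 0} = {z}) :
    IntegrableOn (fun t => lam t * ‖x t - z‖ ^ 2) (Set.Ici (0:ℝ)) volume := by
  have hzm : z ∈ zerSum A D {q : H | B q = 0} := by rw [hz]; rfl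
  obtain ⟨v, hv, p, hp, hvp⟩ := hzm
  have hBz : B z = 0 := hp.1
  have hp3 : (3:ℝ) • p ∈ normalCone {q : H | B q = 0} z := by
    refine ⟨hp.1, fun y hy => ?_⟩
    rw [real_inner_smul_right]
    have := hp.2 y hy
    linarith
  obtain ⟨hac, -, hode⟩ := hsol
  have hlc : ContinuousOn lam (Set.Ici 0) := aux_cont_Ici _ fun b hb => (hH1 b hb).1
  have hbc : ContinuousOn beta (Set.Ici 0) := aux_cont_Ici _ fun b hb => (hH1 b hb).2
  have hxc : ContinuousOn x (Set.Ici 0) := aux_cont_Ici _ fun b hb => by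
    have := (aux_ac0 x x b hb (fun _ _ => le_rfl) (hac b hb)).continuousOn
    rwa [Set.uIcc_of_le hb.le] at this
  have hBc := aux_coco_cont μ hμ B hB
  set F : ℝ → ℝ := fun t => lam t * ⟪x t - z, (3:ℝ) • p⟫ - lam t * beta t * ⟪x t - z, B (x t)⟫
    with hF
  have hFc : ContinuousOn F (Set.Ici 0) := by
    have hBx : ContinuousOn (fun t => B (x t)) (Set.Ici 0) := hBc.comp_continuousOn hxc
    have hxz : ContinuousOn (fun t => x t - z) (Set.Ici 0) := hxc.sub continuousOn_const
    exact (hlc.mul (hxz.inner continuousOn_const)).sub ((hlc.mul hbc).mul (hxz.inner hBx))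
  have hFi : IntegrableOn (fun t => max (F t) 0) (Set.Ici 0) := by
    refine ⟨(hFc.sup continuousOn_const).aestronglyMeasurable measurableSet_Ici, ?_⟩
    have hnn : 0 ≤ᵐ[volume.restrict (Set.Ici 0)] fun t => max (F t) 0 :=
      ae_of_all _ fun t => le_max_right _ _
    rw [hasFiniteIntegral_iff_ofReal hnn]
    refine lt_of_le_of_lt ?_ (hfitz _ z hp3)
    refine setLIntegral_mono' measurableSet_Ici fun t ht => ?_
    rw [ENNReal.ofReal_max, ENNReal.ofReal_zero, max_eq_left zero_le]
    exact aux_fitz B z ((3:ℝ) • p) (x t) (lam t) (beta t) (hlam_pos t ht) (hbeta_pos t ht) hp3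
  obtain ⟨T0, hT0⟩ := eventually_atTop.1 (eventually_lt_of_limsup_lt hls)
  set T := max T0 1 with hT
  have hTpos : 0 < T := lt_of_lt_of_le one_pos (le_max_right _ _)
  have hsub : Set.Ioi T ⊆ Set.Ici 0 := fun t ht => hTpos.le.trans (le_of_lt ht)
  set l : ℝ → ℝ := fun t => lam (max t 0) with hl
  have hleq : ∀ t, 0 ≤ t → l t = lam t := fun t ht => by simp [hl, ht]
  have hlcont : Continuous l :=
    hlc.comp_continuous (continuous_id.max continuous_const) fun t => Set.mem_Ici.2 (le_max_right _ _)
  have hl0 : ∀ t, 0 ≤ l t := fun t => (hlam_pos _ (le_max_right _ _)).le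
  have hl2 : IntegrableOn (fun t => l t ^ 2) (Set.Ioi T) := by
    refine (hH3.1.mono_set hsub).congr_fun (fun t ht => ?_) measurableSet_Ioi
    simp only [hleq t (hsub ht)]
  have key : IntegrableOn (fun t => l t * ‖x t - z‖ ^ 2) (Set.Ioi T) := by
    refine aux_gronwall T (2 * γ) (6 / η ^ 2 + 24 * γ ^ 2) (by positivity) (by positivity)
      (fun t => ‖x t - z‖ ^ 2) l (fun t => 6 * ‖p‖ ^ 2 * l t ^ 2 + 2 / 3 * max (F t) 0)
      hlcont hl0 (fun t => by positivity) (fun t => by positivity) ?_ hl2 ?_ ?_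
    · exact (hl2.const_mul _).add ((hFi.mono_set hsub).const_mul _)
    · intro b hb
      refine (aux_ac x b (hTpos.trans hb) z (hac b (hTpos.trans hb))).mono ?_
      rw [Set.uIcc_of_le hb.le, Set.uIcc_of_le (hTpos.trans hb).le]
      exact Set.Icc_subset_Icc_left hTpos.le
    · filter_upwards [ae_restrict_of_ae_restrict_of_subset hsub hode,
        ae_restrict_mem measurableSet_Ioi] with t ht htT
      have ht0 : 0 ≤ t := hsub htT
      obtain ⟨hxd, hin⟩ := ht
      refine ⟨2 * ⟪x t - z, xd t⟫, (hxd.sub_const z).norm_sq, ?_⟩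
      obtain ⟨w, hw, hweq⟩ := Set.mem_smul_set.1 hin
      have hlb : lam t * beta t ≤ 2 * μ := by
        have := hT0 t ((le_max_left T0 1).trans (le_of_lt htT))
        exact (EReal.coe_lt_coe_iff.1 this).le
      have hveq : v = -(D z + p) := by
        rw [eq_neg_iff_add_eq_zero, ← add_assoc]; exact hvp
      simp only [hleq t ht0, hF]
      refine aux_pointwise (lam t) (beta t) γ η μ (hlam_pos t ht0) (hbeta_pos t ht0) hγ hη hμ hlb
        (x t - z) (xd t) (D (x t) - D z) (B (x t)) p (w - v) ?_ ?_ (hD _ _) ?_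
      · rw [smul_sub, hweq, hveq]; module
      · have := hsm hw hv
        rwa [show xd t + x t - z = x t - z + xd t by abel] at this
      · have := hB (x t) z
        rwa [hBz, sub_zero] at this
  have key2 : IntegrableOn (fun t => lam t * ‖x t - z‖ ^ 2) (Set.Ioi T) := by
    refine key.congr_fun (fun t ht => ?_) measurableSet_Ioi
    simp only [hleq t (hsub ht)]
  have key3 : IntegrableOn (fun t => lam t * ‖x t - z‖ ^ 2) (Set.Icc 0 T) := by
    refine ContinuousOn.integrableOn_Icc (ContinuousOn.mono ?_ Set.Icc_subset_Ici_self)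
    exact hlc.mul ((hxc.sub continuousOn_const).norm.pow 2)
  have := key3.union key2
  rwa [Set.Icc_union_Ioi_eq_Ici hTpos.le] at this
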